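/- arXiv:1810.01563 — 3 statements merged into one kernel-verified Lean document; each statement's English description precedes it below -/
import Mathlib

section
/- Let Λ be a quasi-alternating lattice with vertex set V. Then every vertex v ∈ V is irreducible: whenever v = x + y with x, y ∈ Λ and ⟨x,y⟩ ≥ 0, then x = 0 or y = 0. -/
/-- The negative continued fraction `[a_0, …, a_{n-1}]⁻ = a_0 − 1/[a_1, …, a_{n-1}]⁻`
(with junk value `1` for the empty list). -/
def negCF : (ℕ → ℤ) → ℕ → ℚ
  | _, 0 => 1
  | a, 1 => a 0
  | a, n + 2 => (a 0 : ℚ) - 1 / negCF (fun i => a (i + 1)) (n + 1)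

/-- The index set of the vertices of the star-shaped plumbing with central vertex
(`Sum.inl ()`) and three arms of lengths `k`, `l`, `m`.  Here `Sum.inr (Sum.inl i)`
represents the vertex `uᵃ_{i+1}`, etc. -/
abbrev QAIdx (k l m : ℕ) := Unit ⊕ (Fin k ⊕ (Fin l ⊕ Fin m))

/-- The pairing of the basis vectors (vertices) of the quasi-alternating lattice:
the central vertex has self-pairing `2`, the `i`-th vertex of each arm has
self-pairing given by the corresponding weight (`a`, `b` or `c`), consecutive
vertices of an arm and the central vertex with the first vertex of each arm pair
to `−1`, and all other pairings vanish. -/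
def qaForm (k l m : ℕ) (a b c : ℕ → ℤ) : QAIdx k l m → QAIdx k l m → ℤ
  | Sum.inl _, Sum.inl _ => 2
  | Sum.inl _, Sum.inr (Sum.inl i) => if i.val = 0 then -1 else 0
  | Sum.inr (Sum.inl i), Sum.inl _ => if i.val = 0 then -1 else 0
  | Sum.inl _, Sum.inr (Sum.inr (Sum.inl i)) => if i.val = 0 then -1 else 0
  | Sum.inr (Sum.inr (Sum.inl i)), Sum.inl _ => if i.val = 0 then -1 else 0
  | Sum.inl _, Sum.inr (Sum.inr (Sum.inr i)) => if i.val = 0 then -1 else 0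
  | Sum.inr (Sum.inr (Sum.inr i)), Sum.inl _ => if i.val = 0 then -1 else 0
  | Sum.inr (Sum.inl i), Sum.inr (Sum.inl j) =>
      if i = j then a i.val else if i.val + 1 = j.val ∨ j.val + 1 = i.val then -1 else 0
  | Sum.inr (Sum.inr (Sum.inl i)), Sum.inr (Sum.inr (Sum.inl j)) =>
      if i = j then b i.val else if i.val + 1 = j.val ∨ j.val + 1 = i.val then -1 else 0
  | Sum.inr (Sum.inr (Sum.inr i)), Sum.inr (Sum.inr (Sum.inr j)) =>
      if i = j then c i.val else if i.val + 1 = j.val ∨ j.val + 1 = i.val then -1 else 0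
  | _, _ => 0

/-- The symmetric bilinear form of the quasi-alternating lattice, on elements
written in coordinates with respect to the vertex basis. -/
def qaInner (k l m : ℕ) (a b c : ℕ → ℤ) (x y : QAIdx k l m → ℤ) : ℤ :=
  ∑ v : QAIdx k l m, ∑ w : QAIdx k l m, x v * y w * qaForm k l m a b c v w

/-- The vertex `v` as an element of the quasi-alternating lattice. -/
def qaBasis (k l m : ℕ) (v : QAIdx k l m) : QAIdx k l m → ℤ :=
  fun w => if w = v then 1 else 0

/-- arm form -/
def armF : ℤ → ℤ → List (ℤ × ℤ × ℤ) → ℤ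
  | _, _, [] => 0
  | t, s, (w, x, y) :: l => w * x * y - t * y - x * s + armF x y l

def armE : List (ℤ × ℤ × ℤ) → ℤ
  | [] => 0
  | (_, x, y) :: l => (x - y) + armE l

def armG : List (ℤ × ℤ × ℤ) → Prop
  | [] => True
  | (w, x, y) :: l => 2 ≤ w ∧ y ≤ x ∧ armG l

def armR : List (ℤ × ℤ × ℤ) → ℚ
  | [] => 0
  | (w, _, _) :: l => 1 / ((w : ℚ) - armR l)

theorem mul_close {m n : ℤ} (h1 : m - n ≤ 1) (h2 : n - m ≤ 1) : 0 ≤ m * n := by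
  rcases lt_trichotomy n 0 with h | h | h
  · exact mul_nonneg_of_nonpos_of_nonpos (by omega) (by omega)
  · simp [h]
  · exact mul_nonneg (by omega) (by omega)

theorem armE_nonneg : ∀ l, armG l → 0 ≤ armE l
  | [], _ => le_refl _
  | (w, x, y) :: l, h => by
    have := armE_nonneg l h.2.2
    have := h.2.1
    simp only [armE]; omega

theorem armR_bd : ∀ l, armG l → 0 ≤ armR l ∧ armR l < 1
  | [], _ => by simp [armR]
  | (w, x, y) :: l, h => by
    have h1 := armR_bd l h.2.2
    have h2 : (2 : ℚ) ≤ w := by exact_mod_cast h.1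
    simp only [armR]
    constructor
    · apply div_nonneg <;> linarith
    · rw [div_lt_one] <;> linarith

theorem armK_nonneg : ∀ l t s, armG l → s ≤ t → (t - s) + armE l ≤ 1 → 0 ≤ t * s + armF t s l
  | [], t, s, _, h, h1 => by
    simp only [armE] at h1
    simp only [armF, add_zero]
    exact mul_close (by omega) (by omega)
  | (w, x, y) :: l, t, s, hg, h, h1 => by
    obtain ⟨hw, hyx, hg⟩ := hg
    have he := armE_nonneg l hg
    simp only [armE] at h1
    have a1 := armK_nonneg l x y hg hyx (by omega)
    have a2 : 0 ≤ (t - x) * (s - y) := mul_close (by omega) (by omega)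
    have a3 : 0 ≤ (w - 2) * (x * y) := mul_nonneg (by omega) (mul_close (by omega) (by omega))
    simp only [armF]
    nlinarith

theorem armPD : ∀ l (t : ℤ), armG l → armE l = 0 → -(armR l) * t ^ 2 ≤ armF t t l
  | [], t, _, _ => by simp [armR, armF]
  | (w, x, y) :: l, t, hg, h => by
    obtain ⟨hw, hyx, hg⟩ := hg
    have he := armE_nonneg l hg
    simp only [armE] at h
    obtain rfl : x = y := by omega
    have ih := armPD l x hg (by omega)
    have hb := armR_bd l hg
    have h2 : (2 : ℚ) ≤ w := by exact_mod_cast hw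
    simp only [armF, armR]
    push_cast
    have hp : 0 < (w : ℚ) - armR l := by linarith
    have key : -(1 / ((w : ℚ) - armR l)) * t ^ 2 ≤ ((w : ℚ) - armR l) * x ^ 2 - 2 * t * x := by
      have : ((w : ℚ) - armR l) * x ^ 2 - 2 * t * x - (-(1 / ((w : ℚ) - armR l)) * t ^ 2)
        = (1 / ((w : ℚ) - armR l)) * (((w : ℚ) - armR l) * x - t) ^ 2 := by
        field_simp; ring
      have h3 : 0 ≤ (1 / ((w : ℚ) - armR l)) * (((w : ℚ) - armR l) * x - t) ^ 2 := by positivity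
      linarith
    nlinarith

theorem blow_cond {p q b : ℚ} (hp : 0 ≤ p) (hp1 : p < 1) (hq : 0 ≤ q) (hq1 : q < 1) (hb : 2 ≤ b)
    (h : 1 / (2 - p) + 1 / (b - q) < 1) : 2 < b ∧ p + 1 / (b - 1 - q) < 1 := by
  have h1 : 0 < 2 - p := by linarith
  have h2 : 0 < b - q := by linarith
  rw [div_add_div _ _ h1.ne' h2.ne', div_lt_one (mul_pos h1 h2)] at h
  have h3 : 2 < b - q := by
    by_contra hc
    push Not at hc
    nlinarith
  refine ⟨by linarith, ?_⟩
  have h4 : 1 / (b - 1 - q) < 1 - p := by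
    rw [div_lt_iff₀ (by linarith)]
    nlinarith
  linarith

theorem main_nonneg : ∀ N : ℕ, ∀ L R t s, L.length + R.length ≤ N → armG L → armG R → s ≤ t →
    (t - s) + armE L + armE R ≤ 1 → armR L + armR R < 1 →
    0 ≤ t * s + armF t s L + armF t s R := by
  intro N
  induction N with
  | zero =>
    intro L R t s hN hL hR hst hE hr
    have h1 : L = [] := List.length_eq_zero_iff.mp (by omega)
    subst h1
    have h1 : R = [] := List.length_eq_zero_iff.mp (by omega)
    subst h1
    have := armK_nonneg [] t s trivial hst (by simpa [armE] using hE)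
    simpa [armF] using this
  | succ N ih =>
    intro L R t s hN hL hR hst hE hr
    match L, R with
    | [], R =>
      have := armK_nonneg R t s hR hst (by simpa [armE] using hE)
      simpa [armF] using this
    | L, [] =>
      have := armK_nonneg L t s hL hst (by simpa [armE] using hE)
      simpa [armF] using this
    | (a, x, y) :: L, (b, x', y') :: R =>
      obtain ⟨ha, hyx, hL⟩ := hL
      obtain ⟨hb, hyx', hR⟩ := hR
      have eL := armE_nonneg L hL
      have eR := armE_nonneg R hR
      have rL := armR_bd L hL
      have rR := armR_bd R hR
      simp only [armE, armR, List.length_cons] at *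
      have ha' : (2 : ℚ) ≤ a := by exact_mod_cast ha
      have hb' : (2 : ℚ) ≤ b := by exact_mod_cast hb
      have p0 : 0 ≤ (t - x - x') * (s - y - y') := mul_close (by omega) (by omega)
      by_cases ha2 : a = 2
      · subst ha2
        obtain ⟨c1, c2⟩ := blow_cond rL.1 rL.2 rR.1 rR.2 hb' (by exact_mod_cast hr)
        have c1' : 2 < b := by exact_mod_cast c1
        have := ih L ((b - 1, x', y') :: R) x y (by simp only [List.length_cons]; omega) hL
          ⟨by omega, hyx', hR⟩ hyx (by simp only [armE]; omega)
          (by simp only [armR]; push_cast; exact c2)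
        simp only [armF] at this ⊢
        linarith
      by_cases hb2 : b = 2
      · subst hb2
        obtain ⟨c1, c2⟩ := blow_cond rR.1 rR.2 rL.1 rL.2 ha' (by rw [add_comm]; exact_mod_cast hr)
        have c1' : 2 < a := by exact_mod_cast c1
        have := ih R ((a - 1, x, y) :: L) x' y' (by simp only [List.length_cons]; omega) hR
          ⟨by omega, hyx, hL⟩ hyx' (by simp only [armE]; omega)
          (by simp only [armR]; push_cast; exact c2)
        simp only [armF] at this ⊢
        linarith
      have p1 : 0 ≤ (x - x') * (y - y') := mul_close (by omega) (by omega)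
      have p2 : 0 ≤ (a - 3) * (x * y) := mul_nonneg (by omega) (mul_close (by omega) (by omega))
      have p3 : 0 ≤ (b - 3) * (x' * y') := mul_nonneg (by omega) (mul_close (by omega) (by omega))
      have k1 := armK_nonneg L x y hL hyx (by omega)
      have k2 := armK_nonneg R x' y' hR hyx' (by omega)
      simp only [armF]
      linarith

theorem armA : ∀ l t s, armG l → armE l = 0 → s ≤ t → t - s ≤ 1 → t * s + armF t s l = 0 →
    t * s = 0 ∧ ∀ p ∈ l, p.2.1 = 0 ∧ p.2.2 = 0
  | [], t, s, _, _, _, _, h => by simpa [armF] using h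
  | (w, x, y) :: l, t, s, hg, hE, hst, hst1, h => by
    obtain ⟨hw, hyx, hg⟩ := hg
    have he := armE_nonneg l hg
    simp only [armE] at hE
    obtain rfl : x = y := by omega
    have a1 := armK_nonneg l x x hg hyx (by omega)
    have a2 : 0 ≤ (t - x) * (s - x) := mul_close (by omega) (by omega)
    have a3 : 0 ≤ (w - 2) * (x * x) := mul_nonneg (by omega) (mul_close (by omega) (by omega))
    simp only [armF] at h
    have h0 : x * x + armF x x l = 0 := by nlinarith
    obtain ⟨hx, hl⟩ := armA l x x hg (by omega) le_rfl (by omega) h0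
    obtain rfl : x = 0 := by simpa using hx
    refine ⟨by nlinarith, ?_⟩
    intro p hp
    rcases List.mem_cons.mp hp with rfl | hp
    · simp
    · exact hl p hp

theorem armB : ∀ l, armG l → armE l ≤ 1 → armF 0 0 l = 0 →
    (∀ p ∈ l, p.2.1 = 0) ∨ (∀ p ∈ l, p.2.2 = 0)
  | [], _, _, _ => by simp
  | (w, x, y) :: l, hg, hE, h => by
    obtain ⟨hw, hyx, hg⟩ := hg
    have he := armE_nonneg l hg
    simp only [armE] at hE
    have a1 := armK_nonneg l x y hg hyx (by omega)
    have a2 : 0 ≤ x * y := mul_close (by omega) (by omega)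
    have a3 : 0 ≤ (w - 2) * (x * y) := mul_nonneg (by omega) a2
    simp only [armF] at h
    have h0 : x * y + armF x y l = 0 := by nlinarith
    have h1 : x * y = 0 := by nlinarith
    by_cases hc : x = y
    · subst hc
      obtain rfl : x = 0 := by simpa using h1
      have := armB l hg (by omega) (by simpa using h0)
      simpa using this
    · obtain ⟨_, hl⟩ := armA l x y hg (by omega) hyx (by omega) h0
      rcases mul_eq_zero.mp h1 with rfl | rfl
      · left
        intro p hp
        rcases List.mem_cons.mp hp with rfl | hp
        · rfl
        · exact (hl p hp).1
      · right
        intro p hp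
        rcases List.mem_cons.mp hp with rfl | hp
        · rfl
        · exact (hl p hp).2

/-- list of an arm -/
def armL (k : ℕ) (w : ℕ → ℤ) (x y : Fin k → ℤ) : List (ℤ × ℤ × ℤ) :=
  List.ofFn (fun i : Fin k => (w i.val, x i, y i))

theorem armL_succ (k : ℕ) (w : ℕ → ℤ) (x y : Fin (k+1) → ℤ) :
    armL (k+1) w x y = (w 0, x 0, y 0) ::
      armL k (fun i => w (i+1)) (fun i => x i.succ) (fun i => y i.succ) := by
  simp [armL, List.ofFn_succ]

theorem armL_F : ∀ (k : ℕ) (w : ℕ → ℤ) (x y : Fin k → ℤ) (t s : ℤ),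
    armF t s (armL k w x y) =
      (∑ i : Fin k, t * y i * (if i.val = 0 then -1 else 0)) +
      ((∑ i : Fin k, x i * s * (if i.val = 0 then -1 else 0)) +
      ∑ i : Fin k, ∑ j : Fin k, x i * y j * (if i = j then w i.val else
        if i.val + 1 = j.val ∨ j.val + 1 = i.val then -1 else 0))
  | 0, w, x, y, t, s => by simp [armL, armF]
  | k+1, w, x, y, t, s => by
    rw [armL_succ]
    simp only [armF]
    rw [armL_F k]
    simp only [Fin.sum_univ_succ, Finset.sum_add_distrib]
    simp [Fin.ext_iff, eq_comm]
    ring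

theorem armL_R : ∀ (k : ℕ) (w : ℕ → ℤ) (x y : Fin (k+1) → ℤ),
    armR (armL (k+1) w x y) = 1 / negCF w (k+1)
  | 0, w, x, y => by simp [armL, armR, negCF]
  | k+1, w, x, y => by
    rw [armL_succ, armR, armL_R k, negCF]

theorem armL_G : ∀ (k : ℕ) (w : ℕ → ℤ) (x y : Fin k → ℤ), (∀ i < k, 2 ≤ w i) →
    (∀ i, y i ≤ x i) → armG (armL k w x y)
  | 0, w, x, y, _, _ => by simp [armL, armG]
  | k+1, w, x, y, h1, h2 => by
    rw [armL_succ]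
    exact ⟨h1 0 (by omega), h2 0, armL_G k _ _ _ (fun i hi => h1 (i+1) (by omega))
      (fun i => h2 i.succ)⟩

theorem armL_E : ∀ (k : ℕ) (w : ℕ → ℤ) (x y : Fin k → ℤ),
    armE (armL k w x y) = ∑ i, (x i - y i)
  | 0, w, x, y => by simp [armL, armE]
  | k+1, w, x, y => by
    rw [armL_succ, armE, armL_E k, Fin.sum_univ_succ]

theorem armL_mem {k : ℕ} {w : ℕ → ℤ} {x y : Fin k → ℤ} {P : ℤ × ℤ × ℤ → Prop}
    (h : ∀ p ∈ armL k w x y, P p) (i : Fin k) : P (w i.val, x i, y i) := by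
  apply h
  simp only [armL, List.mem_ofFn]
  exact ⟨i, rfl⟩

theorem qaInner_eq (k l m : ℕ) (a b c : ℕ → ℤ) (x y : QAIdx k l m → ℤ) :
    qaInner k l m a b c x y = 2 * (x (Sum.inl ()) * y (Sum.inl ())) +
      armF (x (Sum.inl ())) (y (Sum.inl ())) (armL k a (fun i => x (Sum.inr (Sum.inl i)))
        (fun i => y (Sum.inr (Sum.inl i)))) +
      armF (x (Sum.inl ())) (y (Sum.inl ())) (armL l b (fun i => x (Sum.inr (Sum.inr (Sum.inl i))))
        (fun i => y (Sum.inr (Sum.inr (Sum.inl i))))) +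
      armF (x (Sum.inl ())) (y (Sum.inl ())) (armL m c (fun i => x (Sum.inr (Sum.inr (Sum.inr i))))
        (fun i => y (Sum.inr (Sum.inr (Sum.inr i))))) := by
  rw [armL_F, armL_F, armL_F]
  simp only [qaInner, Fintype.sum_sum_type, Finset.univ_unique, Finset.sum_singleton, qaForm,
    PUnit.default_eq_unit, Finset.sum_add_distrib, mul_zero, Finset.sum_const_zero]
  ring

theorem core (A B C : List (ℤ × ℤ × ℤ)) (t s : ℤ) (hA : armG A) (hB : armG B) (hC : armG C)
    (hst : s ≤ t) (hE : (t - s) + armE A + armE B + armE C = 1) (hr : armR A + armR B < 1)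
    (h : 2 * (t * s) + armF t s A + armF t s B + armF t s C ≤ 0) :
    (t = 0 ∧ (∀ p ∈ A, p.2.1 = 0) ∧ (∀ p ∈ B, p.2.1 = 0) ∧ (∀ p ∈ C, p.2.1 = 0)) ∨
    (s = 0 ∧ (∀ p ∈ A, p.2.2 = 0) ∧ (∀ p ∈ B, p.2.2 = 0) ∧ (∀ p ∈ C, p.2.2 = 0)) := by
  have eA := armE_nonneg A hA
  have eB := armE_nonneg B hB
  have eC := armE_nonneg C hC
  have hF := main_nonneg _ A B t s le_rfl hA hB hst (by omega) hr
  have hK := armK_nonneg C t s hC hst (by omega)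
  have hA0 := armK_nonneg A t s hA hst (by omega)
  have hB0 := armK_nonneg B t s hB hst (by omega)
  have hF0 : t * s + armF t s A + armF t s B = 0 := by linarith
  have hK0 : t * s + armF t s C = 0 := by linarith
  have hts : t * s = 0 := by
    by_cases hc : armE C = 0
    · exact (armA C t s hC hc hst (by omega) hK0).1
    · obtain rfl : t = s := by omega
      have p1 := armPD A t hA (by omega)
      have p2 := armPD B t hB (by omega)
      have hq : (t : ℚ) * t + armF t t A + armF t t B = 0 := by exact_mod_cast hF0
      by_contra hne
      have ht : (t : ℚ) ≠ 0 := by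
        intro h0
        apply hne
        have : t = 0 := by exact_mod_cast h0
        simp [this]
      have : (0 : ℚ) < t ^ 2 := by positivity
      nlinarith
  have hA1 : t * s + armF t s A = 0 := by linarith
  have hB1 : t * s + armF t s B = 0 := by linarith
  have fin : ∀ l, armG l → armE l = 0 → t * s + armF t s l = 0 →
      (∀ p ∈ l, p.2.1 = 0) ∧ (∀ p ∈ l, p.2.2 = 0) := by
    intro l h1 h2 h3
    have := (armA l t s h1 h2 hst (by omega) h3).2
    exact ⟨fun p hp => (this p hp).1, fun p hp => (this p hp).2⟩
  have finB : t = s → ∀ l, armG l → armE l ≤ 1 → t * s + armF t s l = 0 → t = 0 ∧ s = 0 ∧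
      ((∀ p ∈ l, p.2.1 = 0) ∨ (∀ p ∈ l, p.2.2 = 0)) := by
    intro h0 l h1 h2 h3
    subst h0
    obtain rfl : t = 0 := by simpa using hts
    exact ⟨rfl, rfl, armB l h1 h2 (by simpa using h3)⟩
  by_cases h0 : t = s
  · obtain ⟨t0, s0, a⟩ := finB h0 A hA (by omega) hA1
    obtain ⟨-, -, b⟩ := finB h0 B hB (by omega) hB1
    obtain ⟨-, -, c⟩ := finB h0 C hC (by omega) hK0
    by_cases cA : armE A = 0
    · have a' := fin A hA cA hA1
      by_cases cB : armE B = 0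
      · have b' := fin B hB cB hB1
        tauto
      · have c' := fin C hC (by omega) hK0
        tauto
    · have b' := fin B hB (by omega) hB1
      have c' := fin C hC (by omega) hK0
      tauto
  · have a' := fin A hA (by omega) hA1
    have b' := fin B hB (by omega) hB1
    have c' := fin C hC (by omega) hK0
    rcases mul_eq_zero.mp hts with h | h
    · tauto
    · tauto

/-- In a quasi-alternating lattice, every vertex `v` is irreducible:  whenever
`v = x + y` with `⟨x,y⟩ ≥ 0`, then `x = 0` or `y = 0`. -/
theorem stmt_7 (k l m : ℕ) (hk : 1 ≤ k) (hl : 1 ≤ l) (hm : 1 ≤ m)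
    (a b c : ℕ → ℤ)
    (ha : ∀ i < k, 2 ≤ a i) (hb : ∀ i < l, 2 ≤ b i) (hc : ∀ i < m, 2 ≤ c i)
    (hcf : 1 / negCF a k + 1 / negCF b l < 1)
    (v : QAIdx k l m) (x y : QAIdx k l m → ℤ)
    (hxy : qaBasis k l m v = x + y)
    (hpair : 0 ≤ qaInner k l m a b c x y) :
    x = 0 ∨ y = 0 := by
  have hv : ∀ w, x w - (-y) w = if w = v then 1 else 0 := by
    intro w
    have := congrFun hxy w
    simp only [qaBasis, Pi.add_apply] at this
    simp only [Pi.neg_apply]; omega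
  have hle : ∀ w, (-y) w ≤ x w := by
    intro w
    have := hv w
    split_ifs at this <;> omega
  have hneg : qaInner k l m a b c x (-y) ≤ 0 := by
    have : qaInner k l m a b c x (-y) = - qaInner k l m a b c x y := by
      simp only [qaInner, Pi.neg_apply, mul_neg, neg_mul, Finset.sum_neg_distrib]
    omega
  have hsum : ∑ w, (x w - (-y) w) = 1 := by
    simp only [hv]; simp
  suffices hh : x = 0 ∨ -y = 0 by simpa using hh
  generalize -y = z at *
  obtain ⟨k, rfl⟩ : ∃ k', k = k' + 1 := ⟨k - 1, by omega⟩
  obtain ⟨l, rfl⟩ : ∃ k', l = k' + 1 := ⟨l - 1, by omega⟩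
  rw [qaInner_eq] at hneg
  simp only [Fintype.sum_sum_type, Finset.univ_unique, Finset.sum_singleton,
    PUnit.default_eq_unit] at hsum
  have := core _ _ _ _ _ (armL_G _ _ _ _ ha (fun i => hle _)) (armL_G _ _ _ _ hb (fun i => hle _))
    (armL_G _ _ _ _ hc (fun i => hle _)) (hle _)
    (by rw [armL_E, armL_E, armL_E]; rw [← hsum]; ring)
    (by rw [armL_R, armL_R]; exact hcf) hneg
  rcases this with ⟨h0, h1, h2, h3⟩ | ⟨h0, h1, h2, h3⟩
  · left
    funext w
    rcases w with w | w | w | w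
    · exact h0
    · exact armL_mem h1 w
    · exact armL_mem h2 w
    · exact armL_mem h3 w
  · right
    funext w
    rcases w with w | w | w | w
    · exact h0
    · exact armL_mem h1 w
    · exact armL_mem h2 w
    · exact armL_mem h3 w
end

section
/- Let Λ be a quasi-alternating lattice with vertex set V. Then every vertex v ∈ V is unbreakable: whenever v = x + y with x, y ∈ Λ and ⟨x,y⟩ = −1, then ‖x‖ = 2 or ‖y‖ = 2. -/
def gB {ι : Type*} [Fintype ι] (M : ι → ι → ℤ) (x y : ι → ℤ) : ℤ :=
  ∑ v, ∑ w, x v * y w * M v w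

lemma gB_comm {ι : Type*} [Fintype ι] (M : ι → ι → ℤ) (hM : ∀ v w, M v w = M w v)
    (x y : ι → ℤ) : gB M x y = gB M y x := by
  unfold gB
  rw [Finset.sum_comm]
  refine Finset.sum_congr rfl fun v _ => Finset.sum_congr rfl fun w _ => ?_
  rw [hM]; ring

lemma gB_add {ι : Type*} [Fintype ι] (M : ι → ι → ℤ) (x y z : ι → ℤ) :
    gB M (x + y) z = gB M x z + gB M y z := by
  simp [gB, ← Finset.sum_add_distrib, add_mul]

lemma gB_sub {ι : Type*} [Fintype ι] (M : ι → ι → ℤ) (x y z : ι → ℤ) :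
    gB M (x - y) z = gB M x z - gB M y z := by
  simp [gB, ← Finset.sum_sub_distrib, sub_mul]

lemma gB_nonpos {ι : Type*} [Fintype ι] (M : ι → ι → ℤ)
    (hoff : ∀ v w, v ≠ w → M v w ≤ 0) (x y : ι → ℤ) (hx : ∀ u, 0 ≤ x u) (hy : ∀ u, 0 ≤ y u)
    (hd : ∀ u, x u * y u = 0) : gB M x y ≤ 0 := by
  unfold gB
  refine Finset.sum_nonpos fun v _ => Finset.sum_nonpos fun w _ => ?_
  by_cases h : v = w
  · subst h; rw [hd]; simp
  · exact mul_nonpos_of_nonneg_of_nonpos (mul_nonneg (hx _) (hy _)) (hoff _ _ h)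

lemma gen_aux {ι : Type*} [Fintype ι] [DecidableEq ι] (M : ι → ι → ℤ)
    (hM : ∀ v w, M v w = M w v) (hoff : ∀ v w, v ≠ w → M v w ≤ 0) (hdiag : ∀ v, 2 ≤ M v v)
    (hrat : ∀ p : ι → ℤ, (∀ u, 0 ≤ p u) → p ≠ 0 → 2 + ∑ u, p u * (M u u - 2) ≤ gB M p p)
    (v : ι) (x y : ι → ℤ) (hxy : (fun w => if w = v then 1 else 0) = x + y)
    (hp : gB M x y = -1) (hxv : 1 ≤ x v) : gB M y y = 2 := by
  set e : ι → ℤ := fun w => if w = v then 1 else 0 with he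
  obtain ⟨p, hpdef⟩ : ∃ p : ι → ℤ, p = fun u => max (x u) 0 := ⟨_, rfl⟩
  obtain ⟨q, hqdef⟩ : ∃ q : ι → ℤ, q = fun u => max (- x u) 0 := ⟨_, rfl⟩
  obtain ⟨r, hr⟩ : ∃ r : ι → ℤ, r = p - e := ⟨_, rfl⟩
  have hp0 : ∀ u, 0 ≤ p u := fun u => by simp [hpdef]
  have hq0 : ∀ u, 0 ≤ q u := fun u => by simp [hqdef]
  have hr0 : ∀ u, 0 ≤ r u := fun u => by
    simp only [hr, Pi.sub_apply, he, hpdef]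
    split_ifs with h
    · subst h; have := le_max_left (x u) 0; omega
    · have := le_max_right (x u) 0; omega
  have hpq : ∀ u, p u * q u = 0 := fun u => by
    simp only [hpdef, hqdef]
    rcases le_total (x u) 0 with h | h
    · rw [max_eq_right h]; simp
    · rw [max_eq_right (a := - x u) (by omega)]; simp
  have hqr : ∀ u, q u * r u = 0 := fun u => by
    by_cases h : u = v
    · subst h
      have : q u = 0 := by simp only [hqdef]; omega
      simp [this]
    · have : r u = p u := by simp [hr, he, h]
      rw [this, mul_comm, hpq]
  have hx : x = p - q := by
    funext u; simp only [hpdef, hqdef, Pi.sub_apply]; omega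
  have hpe : p = r + e := by rw [hr]; simp
  have hy : y = q - r := by
    have : y = e - x := by rw [hxy]; simp
    rw [this, hx, hr]; abel
  have hee : gB M e e = M v v := by simp [gB, he]
  have h1 := gB_nonpos M hoff p q hp0 hq0 hpq
  have h2 := gB_nonpos M hoff q r hq0 hr0 hqr
  have hpne : p ≠ 0 := by
    intro h
    have := congrFun h v
    simp only [hpdef, Pi.zero_apply] at this
    omega
  have e1 : gB M x y = gB M p q - gB M p r - gB M q q + gB M q r := by
    rw [hx, hy, gB_sub, gB_comm M hM p, gB_comm M hM q, gB_sub, gB_sub,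
      gB_comm M hM q p, gB_comm M hM r p, gB_comm M hM r q]
    ring
  have e2 : gB M p p = gB M r r + 2 * gB M r e + M v v := by
    rw [hpe, gB_add, gB_comm M hM r, gB_comm M hM e (r + e), gB_add, gB_add, hee,
      gB_comm M hM e r]
    ring
  have e3 : gB M p r = gB M r r + gB M r e := by
    rw [hpe, gB_add, gB_comm M hM e r]
  have e4 : ∑ u, p u * (M u u - 2) = ∑ u, r u * (M u u - 2) + (M v v - 2) := by
    rw [hpe]; simp [he, add_mul, Finset.sum_add_distrib]
  have hK : 0 ≤ ∑ u, r u * (M u u - 2) :=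
    Finset.sum_nonneg fun u _ => mul_nonneg (hr0 u) (by have := hdiag u; omega)
  have hP := hrat p hp0 hpne
  have key : r ≠ 0 → 2 + ∑ u, r u * (M u u - 2) ≤ gB M r r := fun h => hrat r hr0 h
  have keyq : q ≠ 0 → 2 ≤ gB M q q := fun h => by
    have := hrat q hq0 h
    have : 0 ≤ ∑ u, q u * (M u u - 2) :=
      Finset.sum_nonneg fun u _ => mul_nonneg (hq0 u) (by have := hdiag u; omega)
    omega
  have hprn : 0 ≤ gB M p r := by
    by_cases h : r = 0
    · simp [h, gB]
    · have := key h; omega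
  by_cases hq : q = 0
  · have hqq : gB M q q = 0 := by simp [hq, gB]
    have hqr : gB M q r = 0 := by simp [hq, gB]
    have hpq : gB M p q = 0 := by simp [hq, gB]
    have hrne : r ≠ 0 := by
      rintro h
      have : gB M p r = 0 := by simp [h, gB]
      omega
    have := key hrne
    have e5 : gB M y y = gB M r r := by
      rw [hy, hq]; simp [gB]
    omega
  · have := keyq hq
    omega

/-- arm energy -/
def arE : ℤ → List (ℤ × ℤ) → ℤ
  | _, [] => 0
  | s, (w, x) :: L => w * x ^ 2 - 2 * s * x - (w - 2) * x + arE x L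

def arF : List (ℤ × ℤ) → ℚ
  | [] => 0
  | (w, _) :: L => 1 / ((w : ℚ) - arF L)

def Good (L : List (ℤ × ℤ)) : Prop := ∀ z ∈ L, 2 ≤ z.1 ∧ 0 ≤ z.2

def AllZ (L : List (ℤ × ℤ)) : Prop := ∀ z ∈ L, z.2 = 0

lemma good_cons {w x : ℤ} {L} : Good ((w, x) :: L) ↔ (2 ≤ w ∧ 0 ≤ x) ∧ Good L := by
  simp [Good]

lemma allZ_cons {w x : ℤ} {L} : AllZ ((w, x) :: L) ↔ x = 0 ∧ AllZ L := by
  simp [AllZ]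

lemma int_sq (d : ℤ) : d ≤ d ^ 2 ∧ - d ≤ d ^ 2 := by
  constructor
  · nlinarith [Int.le_self_sq d]
  · have := Int.le_self_sq (-d); nlinarith

lemma arE_ge (L : List (ℤ × ℤ)) : ∀ s : ℤ, Good L → s ≤ s ^ 2 + arE s L := by
  induction L with
  | nil => intro s _; simp [arE]; exact (int_sq s).1
  | cons z L ih =>
    obtain ⟨w, x⟩ := z
    intro s h
    rw [good_cons] at h
    have h1 := ih x h.2
    have h2 := (int_sq (s - x)).1
    have h3 : 0 ≤ (w - 2) * (x ^ 2 - x) :=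
      mul_nonneg (by omega) (by have := (int_sq x).1; omega)
    simp only [arE]
    nlinarith

lemma arE_zero (L : List (ℤ × ℤ)) : Good L → AllZ L ∨ 2 ≤ arE 0 L := by
  induction L with
  | nil => intro _; left; simp [AllZ]
  | cons z L ih =>
    obtain ⟨w, x⟩ := z
    intro h
    rw [good_cons] at h
    by_cases hx : x = 0
    · subst hx
      rw [allZ_cons]
      simpa [arE] using ih h.2
    · right
      have h1 := arE_ge L x h.2
      have h3 : 0 ≤ (w - 2) * (x ^ 2 - x) :=
        mul_nonneg (by omega) (by have := (int_sq x).1; omega)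
      have : 1 ≤ x := by omega
      simp only [arE]
      nlinarith

lemma arE_zero' (L : List (ℤ × ℤ)) (h : AllZ L) : arE 0 L = 0 := by
  induction L with
  | nil => rfl
  | cons z L ih =>
    obtain ⟨w, x⟩ := z
    rw [allZ_cons] at h
    obtain ⟨rfl, h⟩ := h
    simp [arE, ih h]

lemma arF_bd (L : List (ℤ × ℤ)) : Good L → 0 ≤ arF L ∧ arF L < 1 := by
  induction L with
  | nil => intro _; simp [arF]
  | cons z L ih =>
    obtain ⟨w, x⟩ := z
    intro h
    rw [good_cons] at h
    obtain ⟨h1, h2⟩ := ih h.2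
    have hw : (2 : ℚ) ≤ w := by exact_mod_cast h.1.1
    simp only [arF]
    constructor
    · apply div_nonneg <;> linarith
    · rw [div_lt_one] <;> linarith

lemma frac_aux (F G : ℚ) (β : ℤ) (hF : 0 ≤ F ∧ F < 1) (hG : 0 ≤ G ∧ G < 1) (hβ : 2 ≤ β)
    (h : 1 / (((2 : ℤ) : ℚ) - F) + 1 / ((β : ℚ) - G) < 1) :
    3 ≤ β ∧ F + 1 / (((β - 1 : ℤ) : ℚ) - G) < 1 := by
  obtain ⟨f0, f1⟩ := hF
  obtain ⟨g0, g1⟩ := hG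
  have hw : (2 : ℚ) ≤ β := by exact_mod_cast hβ
  push_cast at h ⊢
  have p1 : 0 < 2 - F := by linarith
  have p2 : 0 < (β : ℚ) - G := by linarith
  rw [div_add_div _ _ p1.ne' p2.ne', div_lt_one (mul_pos p1 p2)] at h
  have hb : 3 ≤ β := by
    by_contra hc
    have : β = 2 := by omega
    subst this
    push_cast at h
    nlinarith
  refine ⟨hb, ?_⟩
  have hw : (3 : ℚ) ≤ β := by exact_mod_cast hb
  have p3 : 0 < (β : ℚ) - 1 - G := by linarith
  have : 1 / ((β : ℚ) - 1 - G) < 1 - F := by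
    rw [div_lt_iff₀ p3]; nlinarith
  linarith

lemma main_chain (n : ℕ) : ∀ (La Lb : List (ℤ × ℤ)) (t : ℤ), La.length + Lb.length ≤ n →
    Good La → Good Lb → 0 ≤ t → arF La + arF Lb < 1 →
    (t = 0 ∧ AllZ La ∧ AllZ Lb) ∨ 2 ≤ t ^ 2 + t + arE t La + arE t Lb := by
  have base : ∀ (L : List (ℤ × ℤ)) (t : ℤ), Good L → 0 ≤ t →
      (t = 0 ∧ AllZ L) ∨ 2 ≤ t ^ 2 + t + arE t L := by
    intro L t hL ht
    by_cases h : t = 0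
    · subst h
      simpa using arE_zero L hL
    · right
      have := arE_ge L t hL
      omega
  induction n with
  | zero =>
    intro La Lb t hn ha hb ht hf
    have : La = [] := List.length_eq_zero_iff.1 (by omega)
    subst this
    rcases base Lb t hb ht with h | h
    · left; exact ⟨h.1, by simp [AllZ], h.2⟩
    · right; simpa [arE] using h
  | succ n ih =>
    -- the asymmetric blow-down step
    have step : ∀ (s β r t : ℤ) (La Lb : List (ℤ × ℤ)),
        ((2, s) :: La).length + ((β, r) :: Lb).length ≤ n + 1 →
        Good ((2, s) :: La) → Good ((β, r) :: Lb) → 0 ≤ t →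
        arF ((2, s) :: La) + arF ((β, r) :: Lb) < 1 →
        (t = 0 ∧ AllZ ((2, s) :: La) ∧ AllZ ((β, r) :: Lb)) ∨
          2 ≤ t ^ 2 + t + arE t ((2, s) :: La) + arE t ((β, r) :: Lb) := by
      intro s β r t La Lb hn ha hb ht hf
      rw [good_cons] at ha hb
      simp only [arF] at hf
      obtain ⟨h3, hf'⟩ := frac_aux _ _ _ (arF_bd La ha.2) (arF_bd Lb hb.2) hb.1.1 hf
      have := ih La ((β - 1, r) :: Lb) s (by simp at hn ⊢; omega) ha.2
        (by rw [good_cons]; exact ⟨⟨by omega, hb.1.2⟩, hb.2⟩) ha.1.2 (by simpa only [arF] using hf')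
      have hd := (int_sq (t - s - r)).2
      rcases this with ⟨rfl, hz, hz'⟩ | h
      · rw [allZ_cons] at hz'
        obtain ⟨rfl, hz'⟩ := hz'
        simp only [allZ_cons, arE]
        rw [arE_zero' _ hz, arE_zero' _ hz']
        by_cases h : t = 0
        · left; simp [h, hz, hz']
        · right
          have : 1 ≤ t := by omega
          nlinarith
      · right
        simp only [arE] at h ⊢
        nlinarith
    intro La Lb t hn ha hb ht hf
    rcases La with _ | ⟨⟨α, s⟩, La⟩
    · rcases base Lb t hb ht with h | h
      · left; exact ⟨h.1, by simp [AllZ], h.2⟩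
      · right; simpa [arE] using h
    rcases Lb with _ | ⟨⟨β, r⟩, Lb⟩
    · rcases base _ t ha ht with h | h
      · left; exact ⟨h.1, h.2, by simp [AllZ]⟩
      · right; rw [show arE t [] = 0 from rfl]; simpa using h
    by_cases hα : α = 2
    · subst hα
      exact step _ _ _ _ _ _ hn ha hb ht hf
    by_cases hβ : β = 2
    · subst hβ
      rcases step r α s t Lb La (by omega) hb ha ht (by linarith) with h | h
      · left; exact ⟨h.1, h.2.2, h.2.1⟩
      · right; linarith
    rw [good_cons] at ha hb
    have hd := (int_sq (t - s - r)).2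
    have ea := arE_ge La s ha.2
    have eb := arE_ge Lb r hb.2
    have h3 : 0 ≤ (α - 3) * (s ^ 2 - s) :=
        mul_nonneg (by omega) (by have := (int_sq s).1; omega)
    have h4 : 0 ≤ (β - 3) * (r ^ 2 - r) :=
        mul_nonneg (by omega) (by have := (int_sq r).1; omega)
    simp only [allZ_cons, arE]
    have hR : t ^ 2 + t + (α * s ^ 2 - 2 * t * s - (α - 2) * s + arE s La) +
        (β * r ^ 2 - 2 * t * r - (β - 2) * r + arE r Lb) =
        ((t - s - r) ^ 2 + (t - s - r)) + (s - r) ^ 2 + (α - 3) * (s ^ 2 - s) +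
        (β - 3) * (r ^ 2 - r) + (s ^ 2 + arE s La) + (r ^ 2 + arE r Lb) := by ring
    rw [hR]
    by_cases hs : s = 0 ∧ r = 0
    · obtain ⟨rfl, rfl⟩ := hs
      have t2 : 0 < t → 2 ≤ t ^ 2 + t := fun h => by nlinarith
      rcases arE_zero La ha.2 with hz | hz
      · rcases arE_zero Lb hb.2 with hz' | hz'
        · by_cases h : t = 0
          · left; simp [h, hz, hz']
          · right
            have := t2 (by omega)
            simp only [sub_zero]
            linarith
        · right; linarith
      · right; linarith
    · right
      have i1 := (int_sq (s - r)).1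
      have i2 := (int_sq (s - r)).2
      have : 2 ≤ (s - r) ^ 2 + s + r := by
        have := ha.1.2
        have := hb.1.2
        omega
      linarith

/-- chain matrix -/
def chM (n : ℕ) (w : ℕ → ℤ) (i j : Fin n) : ℤ :=
  if i = j then w i.val else if i.val + 1 = j.val ∨ j.val + 1 = i.val then -1 else 0

def mkL (n : ℕ) (w : ℕ → ℤ) (x : Fin n → ℤ) : List (ℤ × ℤ) :=
  List.ofFn fun i : Fin n => (w i.val, x i)

lemma mkL_succ (n : ℕ) (w : ℕ → ℤ) (x : Fin (n + 1) → ℤ) :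
    mkL (n + 1) w x = (w 0, x 0) :: mkL n (fun i => w (i + 1)) (fun i => x i.succ) := by
  simp [mkL, List.ofFn_succ]

lemma chM_succ (n : ℕ) (w : ℕ → ℤ) (i j : Fin n) :
    chM (n + 1) w i.succ j.succ = chM n (fun i => w (i + 1)) i j := by
  simp [chM]

lemma chM_zs (n : ℕ) (w : ℕ → ℤ) (j : Fin n) :
    chM (n + 1) w 0 j.succ = if j.val = 0 then -1 else 0 := by
  have : (0 : Fin (n+1)) ≠ j.succ := (Fin.succ_ne_zero j).symm
  simp [chM, this, eq_comm]

lemma chM_sz (n : ℕ) (w : ℕ → ℤ) (j : Fin n) :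
    chM (n + 1) w j.succ 0 = if j.val = 0 then -1 else 0 := by
  simp [chM, Fin.succ_ne_zero]

lemma chain_E (n : ℕ) : ∀ (w : ℕ → ℤ) (x : Fin n → ℤ) (s : ℤ),
    arE s (mkL n w x) = (∑ i, ∑ j, x i * x j * chM n w i j)
      + 2 * (∑ i : Fin n, s * x i * (if i.val = 0 then -1 else 0)) - ∑ i, x i * (w i.val - 2) := by
  induction n with
  | zero => intro w x s; simp [mkL, arE]
  | succ n ih =>
    intro w x s
    rw [mkL_succ]
    simp only [arE]
    rw [ih]
    simp only [Fin.sum_univ_succ, chM_succ, chM_zs, chM_sz, Finset.sum_add_distrib]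
    have h0 : chM (n + 1) w 0 0 = w 0 := by simp [chM]
    have hs : ∑ i : Fin n, x i.succ * x 0 * (if i.val = 0 then -1 else 0) =
      ∑ i : Fin n, x 0 * x i.succ * (if i.val = 0 then -1 else 0) :=
      Finset.sum_congr rfl fun i _ => by ring
    rw [h0, hs]
    simp
    ring

lemma arF_negCF (n : ℕ) : ∀ (w : ℕ → ℤ) (x : Fin (n + 1) → ℤ),
    1 / negCF w (n + 1) = arF (mkL (n + 1) w x) := by
  induction n with
  | zero => intro w x; simp [mkL, arF, negCF]
  | succ n ih =>
    intro w x
    rw [mkL_succ]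
    simp only [arF, negCF]
    rw [ih _ (fun i => x i.succ)]

lemma mkL_good (n : ℕ) (w : ℕ → ℤ) (x : Fin n → ℤ) (hw : ∀ i < n, 2 ≤ w i)
    (hx : ∀ i, 0 ≤ x i) : Good (mkL n w x) := by
  intro z hz
  simp only [mkL, List.mem_ofFn] at hz
  obtain ⟨i, rfl⟩ := hz
  exact ⟨hw _ i.2, hx i⟩

lemma mkL_allZ (n : ℕ) (w : ℕ → ℤ) (x : Fin n → ℤ) (h : AllZ (mkL n w x)) : ∀ i, x i = 0 := by
  intro i
  exact h (w i.val, x i) (by simp only [mkL, List.mem_ofFn]; exact ⟨i, rfl⟩)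

lemma qa_E (k l m : ℕ) (a b c : ℕ → ℤ) (p : QAIdx k l m → ℤ) :
    gB (qaForm k l m a b c) p p - ∑ u, p u * (qaForm k l m a b c u u - 2) =
      2 * p (Sum.inl ()) ^ 2
      + arE (p (Sum.inl ())) (mkL k a fun i => p (Sum.inr (Sum.inl i)))
      + arE (p (Sum.inl ())) (mkL l b fun i => p (Sum.inr (Sum.inr (Sum.inl i))))
      + arE (p (Sum.inl ())) (mkL m c fun i => p (Sum.inr (Sum.inr (Sum.inr i)))) := by
  have hs : ∀ (n : ℕ) (x : Fin n → ℤ) (s : ℤ), 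
      ∑ i : Fin n, x i * s * (if i.val = 0 then -1 else 0) =
      ∑ i : Fin n, s * x i * (if i.val = 0 then -1 else 0) := fun n x s =>
      Finset.sum_congr rfl fun i _ => by ring
  simp only [chain_E]
  simp only [gB, Fintype.sum_sum_type, qaForm, Finset.sum_add_distrib, hs, chM,
    Finset.univ_unique, Finset.sum_singleton, mul_zero, Finset.sum_const_zero, if_true]
  simp only [PUnit.default_eq_unit]
  ring

/-- In a quasi-alternating lattice, every vertex `v` is unbreakable:  whenever
`v = x + y` with `⟨x,y⟩ = −1`, then `‖x‖ = 2` or `‖y‖ = 2`. -/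
theorem stmt_8 (k l m : ℕ) (hk : 1 ≤ k) (hl : 1 ≤ l) (hm : 1 ≤ m)
    (a b c : ℕ → ℤ)
    (ha : ∀ i < k, 2 ≤ a i) (hb : ∀ i < l, 2 ≤ b i) (hc : ∀ i < m, 2 ≤ c i)
    (hcf : 1 / negCF a k + 1 / negCF b l < 1)
    (v : QAIdx k l m) (x y : QAIdx k l m → ℤ)
    (hxy : qaBasis k l m v = x + y)
    (hpair : qaInner k l m a b c x y = -1) :
    qaInner k l m a b c x x = 2 ∨ qaInner k l m a b c y y = 2 := by
  have hM : ∀ v w, qaForm k l m a b c v w = qaForm k l m a b c w v := by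
    rintro (v | v | v | v) (w | w | w | w) <;> simp only [qaForm]
    all_goals
      by_cases h : v = w
      · subst h; rfl
      · rw [if_neg h, if_neg (Ne.symm h)]
        simp only [or_comm]
  have hoff : ∀ v w, v ≠ w → qaForm k l m a b c v w ≤ 0 := by
    rintro (v | v | v | v) (w | w | w | w) h <;> simp only [qaForm]
    all_goals first
      | exact absurd rfl h
      | exact le_refl _
      | (split_ifs <;> simp; done)
      | (rw [if_neg (by rintro rfl; exact h rfl)]; split_ifs <;> simp)
  have hdiag : ∀ v, 2 ≤ qaForm k l m a b c v v := by
    rintro (v | v | v | v) <;> simp only [qaForm, if_true]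
    · exact le_refl _
    · exact ha _ v.2
    · exact hb _ v.2
    · exact hc _ v.2
  have hrat : ∀ p : QAIdx k l m → ℤ, (∀ u, 0 ≤ p u) → p ≠ 0 →
      2 + ∑ u, p u * (qaForm k l m a b c u u - 2) ≤ gB (qaForm k l m a b c) p p := by
    intro p hp hne
    have hE := qa_E k l m a b c p
    have ga := mkL_good k a (fun i => p (Sum.inr (Sum.inl i))) ha fun _ => hp _
    have gb := mkL_good l b (fun i => p (Sum.inr (Sum.inr (Sum.inl i)))) hb fun _ => hp _
    have gc := mkL_good m c (fun i => p (Sum.inr (Sum.inr (Sum.inr i)))) hc fun _ => hp _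
    have hf : arF (mkL k a fun i => p (Sum.inr (Sum.inl i))) +
        arF (mkL l b fun i => p (Sum.inr (Sum.inr (Sum.inl i)))) < 1 := by
      obtain ⟨k, rfl⟩ : ∃ k', k = k' + 1 := ⟨k - 1, by omega⟩
      obtain ⟨l, rfl⟩ : ∃ k', l = k' + 1 := ⟨l - 1, by omega⟩
      rw [← arF_negCF, ← arF_negCF]
      exact hcf
    have hge := arE_ge _ (p (Sum.inl ())) gc
    rcases main_chain _ _ _ (p (Sum.inl ())) le_rfl ga gb (hp _) hf with ⟨h0, za, zb⟩ | h
    · rw [h0, arE_zero' _ za, arE_zero' _ zb] at hE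
      rcases arE_zero _ gc with zc | h
      · exfalso
        apply hne
        funext u
        rcases u with u | u | u | u
        · exact h0
        · exact mkL_allZ _ _ _ za u
        · exact mkL_allZ _ _ _ zb u
        · exact mkL_allZ _ _ _ zc u
      · linarith
    · linarith
  have hxy' : (fun w => if w = v then (1 : ℤ) else 0) = x + y := hxy
  have hv := congrFun hxy' v
  simp only [if_true, Pi.add_apply] at hv
  by_cases h : 1 ≤ x v
  · right
    exact gen_aux _ hM hoff hdiag hrat v x y hxy' hpair h
  · left
    exact gen_aux _ hM hoff hdiag hrat v y x (by rw [hxy', add_comm])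
      (by rw [gB_comm _ hM]; exact hpair) (by omega)
end

section
/- Let Λ be a quasi-alternating lattice with vertex set V. If x = Σ_{v∈V} c_v·v ∈ Λ (with integer coefficients c_v) is irreducible, then either c_v ≥ 0 for all v ∈ V, or c_v ≤ 0 for all v ∈ V. -/
theorem qaForm_offdiag (k l m : ℕ) (a b c : ℕ → ℤ) (v w : QAIdx k l m) (h : v ≠ w) :
    qaForm k l m a b c v w ≤ 0 := by
  rcases v with v | v | v | v <;> rcases w with w | w | w | w <;>
    simp only [qaForm] <;> first
      | exact absurd rfl h
      | (have h' : v ≠ w := fun e => h (by rw [e])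
         rw [if_neg h']; split_ifs <;> norm_num)
      | (split_ifs <;> norm_num)
      | norm_num

/-- In a quasi-alternating lattice, if `x = Σ c_v v` is irreducible then all the
coefficients `c_v` have the same sign.  Here `x : QAIdx k l m → ℤ` records the
coefficients of `x` in the vertex basis. -/
theorem stmt_9 (k l m : ℕ) (hk : 1 ≤ k) (hl : 1 ≤ l) (hm : 1 ≤ m)
    (a b c : ℕ → ℤ)
    (ha : ∀ i < k, 2 ≤ a i) (hb : ∀ i < l, 2 ≤ b i) (hc : ∀ i < m, 2 ≤ c i)
    (hcf : 1 / negCF a k + 1 / negCF b l < 1)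
    (x : QAIdx k l m → ℤ)
    (hirr : ∀ y z : QAIdx k l m → ℤ, x = y + z →
      0 ≤ qaInner k l m a b c y z → y = 0 ∨ z = 0) :
    (∀ v, 0 ≤ x v) ∨ (∀ v, x v ≤ 0) := by
  have key := hirr (fun v => max (x v) 0) (fun v => min (x v) 0)
    (by funext v; simp only [Pi.add_apply]; omega)
    (by
      unfold qaInner
      refine Finset.sum_nonneg fun v _ => Finset.sum_nonneg fun w _ => ?_
      by_cases h : v = w
      · subst h
        have : max (x v) 0 * min (x v) 0 = 0 := by
          rcases le_total (x v) 0 with h | h <;> simp [h]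
        simp [this]
      · exact mul_nonneg_of_nonpos_of_nonpos
          (mul_nonpos_of_nonneg_of_nonpos (le_max_right _ _) (min_le_right _ _))
          (qaForm_offdiag k l m a b c v w h))
  rcases key with h | h
  · right
    intro v
    have := congrFun h v
    simp only [Pi.zero_apply] at this
    omega
  · left
    intro v
    have := congrFun h v
    simp only [Pi.zero_apply] at this
    omega
end
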